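/- Let C₁ > 0, 1 < b < 2 and ε > 0. Define, for μ > 0 and h ∈ L¹(ℝ³), the operator Γ^μ_ε(h)(p) = Q_ε(h,h)(p) + μ h(p) ∫_{ℝ³} h(q) d³q. Then there exists μ₀ > 0 (depending only on C₁, b, ε) such that for every μ ≥ μ₀ the operator Γ^μ_ε is monotone: if f, g ∈ L¹(ℝ³) satisfy f ≥ g ≥ 0 almost everywhere, then Γ^μ_ε(f) ≥ Γ^μ_ε(g) almost everywhere. -/

import Mathlib

noncomputable section

open MeasureTheory Real Metric
open scoped RealInnerProductSpace

/-- Momentum space `ℝ³`. -/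
abbrev R3 : Type := EuclideanSpace ℝ (Fin 3)

/-- The relative momentum `ρ(p,q) = √(2(|p||q| − p·q))`. -/
def relMom (p q : R3) : ℝ := Real.sqrt (2 * (‖p‖ * ‖q‖ - ⟪p, q⟫))

/-- Post-collision momentum `p'`. -/
def pPost (p q ω : R3) : R3 :=
  (1 / 2 : ℝ) • (p + q) + (relMom p q / 2) • ω
    + (⟪p + q, ω⟫ / 2 / (‖p‖ + ‖q‖ + relMom p q)) • (p + q)

/-- Post-collision momentum `q'`. -/
def qPost (p q ω : R3) : R3 :=
  (1 / 2 : ℝ) • (p + q) - (relMom p q / 2) • ω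
    - (⟪p + q, ω⟫ / 2 / (‖p‖ + ‖q‖ + relMom p q)) • (p + q)

/-- Post-collision energy `p'⁰`. -/
def p0Post (p q ω : R3) : ℝ := (‖p‖ + ‖q‖) / 2 + ⟪p + q, ω⟫ / 2

/-- Post-collision energy `q'⁰`. -/
def q0Post (p q ω : R3) : ℝ := (‖p‖ + ‖q‖) / 2 - ⟪p + q, ω⟫ / 2

/-- The surface measure `dω` on the unit sphere `S² ⊂ ℝ³` (total mass `4π`). -/
def sphMeasure : Measure (sphere (0 : R3) 1) := (volume : Measure R3).toSphere

/-- The (modified, for `ε > 0`) massless Boltzmann collision operator with scattering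
cross-section `σ = C₁ h^{-b}`. -/
def Qcoll (C₁ b ε : ℝ) (f : R3 → ℝ) (p : R3) : ℝ :=
  C₁ * ∫ q : R3, ∫ ω : sphere (0 : R3) 1,
      (if ε ≤ relMom p q then relMom p q ^ (2 - b) / (‖p‖ * ‖q‖) else 0)
        * (f (pPost p q ω) * f (qPost p q ω) - f p * f q) ∂sphMeasure

/-- The operator `Γ^μ_ε(h) = Q_ε(h,h) + μ h ∫ h`. -/
def GammaOp (C₁ b ε μ : ℝ) (h : R3 → ℝ) (p : R3) : ℝ :=
  Qcoll C₁ b ε h p + μ * h p * ∫ q : R3, h q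


/-- total energy as function of total momentum and relative momentum vector -/
def EE (P y : R3) : ℝ := Real.sqrt (‖y‖ ^ 2 + ‖P‖ ^ 2)

def phiC (P y : R3) : ℝ := ⟪P, y⟫ / (2 * ‖y‖ * (EE P y + ‖y‖))

/-- Elliptic coordinates: center of mass parametrization. -/
def PsiC (P y : R3) : R3 := (1 / 2 : ℝ) • (P + y) + phiC P y • P

lemma EE_sq (P y : R3) : EE P y ^ 2 = ‖y‖ ^ 2 + ‖P‖ ^ 2 := by
  unfold EE; rw [Real.sq_sqrt]; positivity

lemma EE_nonneg (P y : R3) : 0 ≤ EE P y := Real.sqrt_nonneg _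

lemma EE_pos (P y : R3) (hy : y ≠ 0) : 0 < EE P y := by
  have := norm_pos_iff.2 hy
  unfold EE; positivity

lemma inner_div_le (P y : R3) (hy : y ≠ 0) : |⟪P, y⟫ / ‖y‖| ≤ EE P y := by
  have h := norm_pos_iff.2 hy
  have h1 : |⟪P, y⟫ / ‖y‖| ≤ ‖P‖ := by
    rw [abs_div, abs_norm, div_le_iff₀ h]
    exact abs_real_inner_le_norm P y
  refine h1.trans ?_
  unfold EE
  apply Real.le_sqrt_of_sq_le
  nlinarith [sq_nonneg ‖y‖]

lemma PsiC_neg (P y : R3) : PsiC P (-y) = P - PsiC P y := by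
  have h : phiC P (-y) = - phiC P y := by
    simp [phiC, EE, neg_div]
  unfold PsiC
  rw [h]
  module

lemma norm_PsiC (P y : R3) (hy : y ≠ 0) : ‖PsiC P y‖ = (EE P y + ⟪P, y⟫ / ‖y‖) / 2 := by
  have hs := norm_pos_iff.2 hy
  have hE := EE_pos P y hy
  have h1 := abs_le.1 (inner_div_le P y hy)
  rw [← sq_eq_sq₀ (norm_nonneg _) (by linarith [h1.1])]
  have hform : PsiC P y = (1 / 2 + phiC P y) • P + (1 / 2 : ℝ) • y := by
    unfold PsiC; module
  rw [hform, norm_add_sq_real, norm_smul, norm_smul, inner_smul_left, inner_smul_right]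
  simp only [mul_pow, Real.norm_eq_abs, sq_abs]
  simp only [conj_trivial]
  obtain ⟨c, hc⟩ : ∃ c, c = ⟪P, y⟫ / ‖y‖ := ⟨_, rfl⟩
  have ht : ⟪P, y⟫ = c * ‖y‖ := by rw [hc]; field_simp
  have hu : 2 * phiC P y * (EE P y + ‖y‖) = c := by
    unfold phiC; rw [hc]; field_simp
  have hE2 := EE_sq P y
  rw [← hc, ht]
  set u := phiC P y
  set E := EE P y
  set s := ‖y‖
  set r := ‖P‖
  have hr : 2 * u * r ^ 2 = c * (E - s) := by
    have : r ^ 2 = (E + s) * (E - s) := by linarith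
    rw [this, ← hu]; ring
  linear_combination (1 / 2 + u / 2) * hr + (c / 4) * hu - (1 / 4) * hE2

lemma norm_sub_PsiC (P y : R3) (hy : y ≠ 0) :
    ‖P - PsiC P y‖ = (EE P y - ⟪P, y⟫ / ‖y‖) / 2 := by
  rw [← PsiC_neg, norm_PsiC P (-y) (by simpa using hy)]
  simp [EE, neg_div, sub_eq_add_neg]

lemma relMom_sq (p q : R3) : relMom p q ^ 2 = (‖p‖ + ‖q‖) ^ 2 - ‖p + q‖ ^ 2 := by
  unfold relMom
  rw [Real.sq_sqrt, norm_add_sq_real]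
  · ring
  · nlinarith [real_inner_le_norm p q]

lemma relMom_nonneg (p q : R3) : 0 ≤ relMom p q := Real.sqrt_nonneg _

lemma relMom_PsiC (P y : R3) (hy : y ≠ 0) : relMom (PsiC P y) (P - PsiC P y) = ‖y‖ := by
  rw [← sq_eq_sq₀ (relMom_nonneg _ _) (norm_nonneg _), relMom_sq, norm_PsiC P y hy,
    norm_sub_PsiC P y hy, add_sub_cancel]
  linear_combination EE_sq P y

lemma EE_eq (p q y : R3) (h : ‖y‖ = relMom p q) : EE (p + q) y = ‖p‖ + ‖q‖ := by
  unfold EE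
  rw [h, relMom_sq, sub_add_cancel, Real.sqrt_sq (by positivity)]

lemma pPost_eq (p q ω : R3) (hω : ‖ω‖ = 1) (h : 0 < relMom p q) :
    pPost p q ω = PsiC (p + q) (relMom p q • ω) := by
  have hn : ‖relMom p q • ω‖ = relMom p q := by
    rw [norm_smul, hω, Real.norm_of_nonneg h.le, mul_one]
  have hphi : phiC (p + q) (relMom p q • ω) =
      ⟪p + q, ω⟫ / 2 / (‖p‖ + ‖q‖ + relMom p q) := by
    unfold phiC
    rw [EE_eq p q _ hn, hn, inner_smul_right]
    have : 0 ≤ ‖p‖ + ‖q‖ := by positivity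
    field_simp
  unfold pPost PsiC
  rw [hphi]
  module

lemma qPost_eq (p q ω : R3) : qPost p q ω = p + q - pPost p q ω := by
  unfold pPost qPost; module

lemma PsiC_injOn (P : R3) : Set.InjOn (PsiC P) {0}ᶜ := by
  intro y hy z hz h
  have hy' : y ≠ 0 := hy
  have hz' : z ≠ 0 := hz
  have a1 := norm_PsiC P y hy'
  have a2 := norm_PsiC P z hz'
  have b1 := norm_sub_PsiC P y hy'
  have b2 := norm_sub_PsiC P z hz'
  have c1 := relMom_PsiC P y hy'
  have c2 := relMom_PsiC P z hz'
  rw [h] at a1 b1 c1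
  have hs : ‖y‖ = ‖z‖ := by rw [← c1, c2]
  have hE : EE P y = EE P z := by linarith
  have ht : ⟪P, y⟫ / ‖y‖ = ⟪P, z⟫ / ‖z‖ := by linarith
  have ht' : ⟪P, y⟫ = ⟪P, z⟫ := by
    rw [hs] at ht
    have := norm_pos_iff.2 hz'
    field_simp at ht
    exact ht
  have hp : phiC P y = phiC P z := by unfold phiC; rw [hs, hE, ht']
  unfold PsiC at h
  rw [hp] at h
  have h2 := add_right_cancel h
  have h3 := smul_right_injective R3 (by norm_num : (1 / 2 : ℝ) ≠ 0) h2
  exact add_left_cancel h3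

lemma PsiC_surj (P p : R3) (h : 0 < relMom p (P - p)) : p ∈ PsiC P '' {0}ᶜ := by
  obtain ⟨q, hq⟩ : ∃ q, q = P - p := ⟨_, rfl⟩
  have hP : P = p + q := by rw [hq]; abel
  rw [← hq] at h
  subst hP
  set s := relMom p q with hsdef
  have hs2 := relMom_sq p q
  rw [← hsdef] at hs2
  obtain ⟨d, hd⟩ : ∃ d, d = (‖p‖ - ‖q‖) / (‖p‖ + ‖q‖ + s) := ⟨_, rfl⟩
  have hpos : 0 < ‖p‖ + ‖q‖ + s := by positivity
  have hd' : d * (‖p‖ + ‖q‖ + s) = ‖p‖ - ‖q‖ := by rw [hd]; field_simp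
  have hPP : ‖p + q‖ ^ 2 = ‖p‖ ^ 2 + 2 * ⟪p, q⟫ + ‖q‖ ^ 2 := norm_add_sq_real p q
  have hin : ⟪p + q, p - q⟫ = ‖p‖ ^ 2 - ‖q‖ ^ 2 := by
    rw [inner_add_left, inner_sub_right, inner_sub_right, real_inner_self_eq_norm_sq,
      real_inner_self_eq_norm_sq, real_inner_comm]; ring
  have hny : ‖p - q - d • (p + q)‖ = s := by
    rw [← sq_eq_sq₀ (norm_nonneg _) h.le, norm_sub_sq_real, inner_smul_right, norm_smul, mul_pow,
      Real.norm_eq_abs, sq_abs, real_inner_comm, hin, norm_sub_sq_real]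
    have e1 : d * ‖p + q‖ ^ 2 = (‖p‖ - ‖q‖) * (‖p‖ + ‖q‖ - s) := by
      have : ‖p + q‖ ^ 2 = (‖p‖ + ‖q‖ + s) * (‖p‖ + ‖q‖ - s) := by linarith
      rw [this, ← hd']; ring
    linear_combination d * e1 - (‖p‖ - ‖q‖) * hd' - hs2 + hPP
  refine ⟨p - q - d • (p + q), ?_, ?_⟩
  · intro h0
    rw [Set.mem_singleton_iff] at h0
    rw [h0, norm_zero] at hny
    linarith
  · have hphi : phiC (p + q) (p - q - d • (p + q)) = d / 2 := by
      unfold phiC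
      rw [hny, EE_eq p q _ hny, inner_sub_right, inner_smul_right, hin,
        real_inner_self_eq_norm_sq]
      rw [div_eq_div_iff (by positivity) (by norm_num)]
      linear_combination (-2 * d) * hs2 - 2 * (‖p‖ + ‖q‖) * hd'
    unfold PsiC
    rw [hphi]
    module

lemma phiC_differentiableAt (P y : R3) (hy : y ≠ 0) : DifferentiableAt ℝ (phiC P) y := by
  have hs := norm_pos_iff.2 hy
  have hn : DifferentiableAt ℝ (fun z : R3 => ‖z‖) y := (differentiableAt_id).norm ℝ hy
  have hE : DifferentiableAt ℝ (EE P) y := by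
    unfold EE
    apply DifferentiableAt.sqrt
    · exact (hn.pow 2).add_const _
    · positivity
  unfold phiC
  simp only [div_eq_mul_inv]
  apply DifferentiableAt.mul
  · exact (differentiableAt_const P).inner ℝ differentiableAt_id
  apply DifferentiableAt.inv
  · exact (hn.const_mul 2).mul (hE.add hn)
  · have := EE_pos P y hy
    positivity

lemma phiC_deriv (P y : R3) (hy : y ≠ 0) :
    1 + 2 * fderiv ℝ (phiC P) y P = 4 * (‖PsiC P y‖ * ‖P - PsiC P y‖) / (EE P y * ‖y‖) := by
  have hs := norm_pos_iff.2 hy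
  have hE := EE_pos P y hy
  have h1 : HasDerivAt (fun τ : ℝ => phiC P (y + τ • P)) (fderiv ℝ (phiC P) y P) 0 := by
    have ha := (phiC_differentiableAt P y hy).hasFDerivAt
    have hb : HasDerivAt (fun τ : ℝ => y + τ • P) P 0 := by
      simpa using ((hasDerivAt_id (0 : ℝ)).smul_const P).const_add y
    exact HasFDerivAt.comp_hasDerivAt_of_eq (0 : ℝ) ha hb (by simp)
  set t := ⟪P, y⟫ with ht
  set r := ‖P‖ with hr
  set s := ‖y‖ with hsd
  set E := EE P y with hEd
  have hE2 : E ^ 2 = s ^ 2 + r ^ 2 := EE_sq P y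
  -- the norm along the line
  have hnsq : ∀ τ : ℝ, ‖y + τ • P‖ ^ 2 = s ^ 2 + 2 * τ * t + τ ^ 2 * r ^ 2 := by
    intro τ
    rw [norm_add_sq_real, inner_smul_right, norm_smul, mul_pow, Real.norm_eq_abs, sq_abs,
      real_inner_comm]
    ring
  have hpoly : HasDerivAt (fun τ : ℝ => s ^ 2 + 2 * τ * t + τ ^ 2 * r ^ 2) (2 * t) 0 := by
    have := ((((hasDerivAt_id (0 : ℝ)).const_mul 2).mul_const t).const_add (s ^ 2)).add
      (((hasDerivAt_id (0 : ℝ)).pow 2).mul_const (r ^ 2))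
    refine this.congr_deriv ?_
    simp
  have hN : HasDerivAt (fun τ : ℝ => ‖y + τ • P‖) (t / s) 0 := by
    have := hpoly.sqrt (by simp; positivity)
    have e : (fun τ : ℝ => ‖y + τ • P‖) =
        fun τ : ℝ => Real.sqrt (s ^ 2 + 2 * τ * t + τ ^ 2 * r ^ 2) := by
      funext τ; rw [← hnsq, Real.sqrt_sq (norm_nonneg _)]
    rw [e]
    refine this.congr_deriv ?_
    simp [Real.sqrt_sq hs.le]
    field_simp
  have hEE : HasDerivAt (fun τ : ℝ => EE P (y + τ • P)) (t / E) 0 := by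
    have := (hpoly.add_const (r ^ 2)).sqrt (by simp; positivity)
    have e : (fun τ : ℝ => EE P (y + τ • P)) =
        fun τ : ℝ => Real.sqrt (s ^ 2 + 2 * τ * t + τ ^ 2 * r ^ 2 + r ^ 2) := by
      funext τ; unfold EE; rw [← hnsq]
    rw [e]
    refine this.congr_deriv ?_
    have : Real.sqrt (s ^ 2 + r ^ 2) = E := rfl
    simp [this]
    field_simp
  have hT : HasDerivAt (fun τ : ℝ => ⟪P, y + τ • P⟫) (r ^ 2) 0 := by
    have e : (fun τ : ℝ => ⟪P, y + τ • P⟫) = fun τ : ℝ => t + τ * r ^ 2 := by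
      funext τ
      rw [inner_add_right, inner_smul_right, real_inner_self_eq_norm_sq]
    rw [e]
    simpa using ((hasDerivAt_id (0 : ℝ)).mul_const (r ^ 2)).const_add t
  have hne : 2 * s * (E + s) ≠ 0 := by positivity
  have h2 := hT.div ((hN.const_mul 2).mul (hEE.add hN)) (by simpa [← hsd, ← hEd] using hne)
  have h3 := h1.unique h2
  rw [h3, norm_PsiC P y hy, norm_sub_PsiC P y hy]
  simp only [zero_smul, add_zero, Pi.add_apply, Pi.mul_apply]
  rw [← ht, ← hsd, ← hEd]
  have hr2 : r ^ 2 = E ^ 2 - s ^ 2 := by linarith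
  rw [hr2]
  have : E + s ≠ 0 := by positivity
  field_simp
  ring

def PsiC' (P y : R3) : R3 →L[ℝ] R3 :=
  (1 / 2 : ℝ) • ContinuousLinearMap.id ℝ R3 + (fderiv ℝ (phiC P) y).smulRight P

lemma PsiC_hasFDerivAt (P y : R3) (hy : y ≠ 0) : HasFDerivAt (PsiC P) (PsiC' P y) y := by
  have h1 := (phiC_differentiableAt P y hy).hasFDerivAt.smul_const P
  have h2 := ((hasFDerivAt_id (𝕜 := ℝ) y).const_add P).const_smul (1 / 2 : ℝ)
  exact h2.add h1

lemma PsiC'_det (P y : R3) (hy : y ≠ 0) :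
    (PsiC' P y).det = ‖PsiC P y‖ * ‖P - PsiC P y‖ / (2 * (EE P y * ‖y‖)) := by
  have h : ((PsiC' P y : R3 →L[ℝ] R3) : R3 →ₗ[ℝ] R3) =
      (1 / 2 : ℝ) • LinearMap.transvection
        ((2 : ℝ) • ((fderiv ℝ (phiC P) y : R3 →L[ℝ] ℝ) : R3 →ₗ[ℝ] ℝ)) P := by
    ext1 v
    simp only [PsiC', LinearMap.smul_apply, LinearMap.transvection.apply]
    simp [smul_smul]
  rw [ContinuousLinearMap.det, h, LinearMap.det_smul, LinearMap.transvection.det]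
  have h2 := phiC_deriv P y hy
  have h3 : Module.finrank ℝ R3 = 3 := by simp
  rw [h3]
  simp only [LinearMap.smul_apply, ContinuousLinearMap.coe_coe, smul_eq_mul]
  rw [h2]
  ring

open scoped ENNReal

/-- The collision kernel. -/
def kC (b ε : ℝ) (p q : R3) : ℝ :=
  if ε ≤ relMom p q then relMom p q ^ (2 - b) / (‖p‖ * ‖q‖) else 0

def wC (b ε : ℝ) (P y : R3) : ℝ :=
  if ε ≤ ‖y‖ then ‖y‖ ^ (2 - b) / (2 * (EE P y * ‖y‖)) else 0

lemma kC_nonneg (b ε : ℝ) (p q : R3) : 0 ≤ kC b ε p q := by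
  have := relMom_nonneg p q
  unfold kC; split_ifs
  · positivity
  · exact le_rfl

lemma relMom_sq_le (p q : R3) : relMom p q ^ 2 ≤ 4 * (‖p‖ * ‖q‖) := by
  unfold relMom
  have h := abs_le.1 (abs_real_inner_le_norm p q)
  rw [Real.sq_sqrt] <;> nlinarith [h.1, h.2]

lemma kC_le (b ε : ℝ) (hb : 0 < b) (hε : 0 < ε) (p q : R3) : kC b ε p q ≤ 4 * ε ^ (-b) := by
  unfold kC; split_ifs with h
  · have hs : 0 < relMom p q := hε.trans_le h
    have h4 := relMom_sq_le p q
    have hpos : 0 < ‖p‖ * ‖q‖ := by nlinarith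
    have h1 : relMom p q ^ (-b) ≤ ε ^ (-b) :=
      Real.rpow_le_rpow_of_nonpos hε h (by linarith)
    have h2 : relMom p q ^ (2 - b) = relMom p q ^ 2 * relMom p q ^ (-b) := by
      rw [sub_eq_add_neg, Real.rpow_add hs]; norm_cast
    rw [div_le_iff₀ hpos, h2]
    have h5 : 0 < relMom p q ^ (-b) := by positivity
    calc relMom p q ^ 2 * relMom p q ^ (-b) ≤ (4 * (‖p‖ * ‖q‖)) * ε ^ (-b) := by gcongr
      _ = _ := by ring
  · positivity

lemma relMom_continuous : Continuous fun z : R3 × R3 => relMom z.1 z.2 := by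
  unfold relMom; fun_prop

lemma kC_measurable (b ε : ℝ) : Measurable fun z : R3 × R3 => kC b ε z.1 z.2 := by
  have h := relMom_continuous.measurable
  unfold kC
  refine Measurable.ite (measurableSet_le measurable_const h) ?_ measurable_const
  exact (h.pow_const _).div (by fun_prop)

lemma pPost_measurable :
    Measurable fun z : (R3 × R3) × sphere (0 : R3) 1 => pPost z.1.1 z.1.2 z.2 := by
  have h : Measurable fun z : (R3 × R3) × sphere (0 : R3) 1 => relMom z.1.1 z.1.2 :=
    relMom_continuous.measurable.comp measurable_fst
  have hω : Measurable fun z : (R3 × R3) × sphere (0 : R3) 1 => (z.2 : R3) :=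
    measurable_subtype_coe.comp measurable_snd
  unfold pPost
  fun_prop

lemma qPost_measurable :
    Measurable fun z : (R3 × R3) × sphere (0 : R3) 1 => qPost z.1.1 z.1.2 z.2 := by
  have := pPost_measurable
  simp only [qPost_eq]
  fun_prop

lemma wC_measurable (b ε : ℝ) (P : R3) : Measurable (wC b ε P) := by
  unfold wC EE
  refine Measurable.ite (measurableSet_le measurable_const measurable_norm) ?_ measurable_const
  fun_prop

lemma PsiC_measurable (P : R3) : Measurable (PsiC P) := by
  unfold PsiC phiC EE
  fun_prop

instance : IsFiniteMeasure sphMeasure := by unfold sphMeasure; infer_instance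

lemma polar_avg (H : R3 → ℝ≥0∞) (hH : Measurable H) :
    ∫⁻ y in ({0}ᶜ : Set R3), ∫⁻ ω : sphere (0 : R3) 1, H (‖y‖ • (ω : R3)) ∂sphMeasure
      = sphMeasure Set.univ * ∫⁻ y in ({0}ᶜ : Set R3), H y := by
  have hmp := (volume : Measure R3).measurePreserving_homeomorphUnitSphereProd
  have hms : MeasurableSet ({0}ᶜ : Set R3) := (measurableSet_singleton _).compl
  set ν := Measure.volumeIoiPow (Module.finrank ℝ R3 - 1)
  have key : ∀ G : sphere (0 : R3) 1 × Set.Ioi (0 : ℝ) → ℝ≥0∞,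
      ∫⁻ y : ({0}ᶜ : Set R3), G (homeomorphUnitSphereProd R3 y)
        ∂(Measure.comap (↑) (volume : Measure R3)) = ∫⁻ z, G z ∂(sphMeasure.prod ν) := by
    intro G
    exact hmp.lintegral_comp_emb (Homeomorph.measurableEmbedding _) G
  have hm : Measurable fun z : sphere (0 : R3) 1 × Set.Ioi (0 : ℝ) =>
      H ((z.2 : ℝ) • (z.1 : R3)) := by
    apply hH.comp
    exact (measurable_subtype_coe.comp measurable_snd).smul
      (measurable_subtype_coe.comp measurable_fst)
  rw [← lintegral_subtype_comap hms, ← lintegral_subtype_comap hms]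
  have e1 := key (fun z => ∫⁻ ω : sphere (0 : R3) 1, H ((z.2 : ℝ) • (ω : R3)) ∂sphMeasure)
  have e2 := key (fun z => H ((z.2 : ℝ) • (z.1 : R3)))
  simp only [homeomorphUnitSphereProd_apply_snd_coe] at e1 e2
  have e3 : ∀ y : ({0}ᶜ : Set R3),
      ‖(y : R3)‖ • ((homeomorphUnitSphereProd R3 y).1 : R3) = y := by
    intro y
    have : ‖(y : R3)‖ ≠ 0 := norm_ne_zero_iff.2 y.2
    simp [homeomorphUnitSphereProd_apply_fst_coe, smul_smul, this]
  simp only [e3] at e2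
  rw [e1, e2]
  have hm2 : Measurable fun r : Set.Ioi (0 : ℝ) =>
      ∫⁻ ω : sphere (0 : R3) 1, H ((r : ℝ) • (ω : R3)) ∂sphMeasure :=
    Measurable.lintegral_prod_left' hm
  rw [lintegral_prod_symm' _ hm]
  rw [lintegral_prod (fun z : sphere (0 : R3) 1 × Set.Ioi (0 : ℝ) =>
    ∫⁻ ω : sphere (0 : R3) 1, H ((z.2 : ℝ) • (ω : R3)) ∂sphMeasure)
    (hm2.comp measurable_snd).aemeasurable]
  simp only [lintegral_const]
  rw [mul_comm]

lemma lintegral_PsiC (P : R3) (H : R3 → ℝ≥0∞)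
    (h0 : ∀ p, H p ≠ 0 → 0 < relMom p (P - p)) :
    ∫⁻ p, H p = ∫⁻ y in ({0}ᶜ : Set R3),
      ENNReal.ofReal (‖PsiC P y‖ * ‖P - PsiC P y‖ / (2 * (EE P y * ‖y‖))) * H (PsiC P y) := by
  have hms : MeasurableSet ({0}ᶜ : Set R3) := (measurableSet_singleton _).compl
  have hd : ∀ y ∈ ({0}ᶜ : Set R3), HasFDerivWithinAt (PsiC P) (PsiC' P y) {0}ᶜ y :=
    fun y hy => (PsiC_hasFDerivAt P y hy).hasFDerivWithinAt
  have h1 := lintegral_image_eq_lintegral_abs_det_fderiv_mul volume hms hd (PsiC_injOn P) H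
  have h2 : ∫⁻ p in PsiC P '' {0}ᶜ, H p = ∫⁻ p, H p := by
    apply setLIntegral_eq_of_support_subset
    intro p hp
    exact PsiC_surj P p (h0 p hp)
  rw [← h2, h1]
  refine setLIntegral_congr_fun hms fun y hy => ?_
  have : 0 ≤ EE P y := EE_nonneg _ _
  rw [PsiC'_det P y hy, abs_of_nonneg (by positivity)]

lemma det_mul_kC (b ε : ℝ) (P y : R3) (hy : y ≠ 0) :
    ENNReal.ofReal (‖PsiC P y‖ * ‖P - PsiC P y‖ / (2 * (EE P y * ‖y‖))) *
      ENNReal.ofReal (kC b ε (PsiC P y) (P - PsiC P y)) = ENNReal.ofReal (wC b ε P y) := by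
  have : 0 ≤ EE P y := EE_nonneg _ _
  rw [← ENNReal.ofReal_mul (by positivity)]
  congr 1
  have hr := relMom_PsiC P y hy
  have hle := relMom_sq_le (PsiC P y) (P - PsiC P y)
  unfold kC wC
  rw [hr] at *
  have hs := norm_pos_iff.2 hy
  have hpos : 0 < ‖PsiC P y‖ * ‖P - PsiC P y‖ := by nlinarith
  have hne := hpos.ne'
  set m := ‖PsiC P y‖ * ‖P - PsiC P y‖
  split_ifs
  · have := EE_pos P y hy
    field_simp
  · simp

lemma fiber_eq (b ε : ℝ) (hε : 0 < ε) (P : R3) (F : R3 → ℝ≥0∞) (hF : Measurable F) :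
    ∫⁻ p, ∫⁻ ω : sphere (0 : R3) 1,
      ENNReal.ofReal (kC b ε p (P - p)) * F (pPost p (P - p) ω) ∂sphMeasure
      = sphMeasure Set.univ * ∫⁻ p, ENNReal.ofReal (kC b ε p (P - p)) * F p := by
  have hk0 : ∀ p, ENNReal.ofReal (kC b ε p (P - p)) ≠ 0 → 0 < relMom p (P - p) := by
    intro p hp
    by_contra hcon
    apply hp
    unfold kC
    rw [if_neg (by linarith)]
    simp
  have hms : MeasurableSet ({0}ᶜ : Set R3) := (measurableSet_singleton _).compl
  rw [lintegral_PsiC P (fun p => ENNReal.ofReal (kC b ε p (P - p)) * F p)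
    (fun p hp => hk0 p (left_ne_zero_of_mul hp))]
  rw [lintegral_PsiC P (fun p => ∫⁻ ω : sphere (0 : R3) 1,
      ENNReal.ofReal (kC b ε p (P - p)) * F (pPost p (P - p) ω) ∂sphMeasure) (by
    intro p hp
    apply hk0 p
    intro h
    apply hp
    simp [h])]
  have hH : Measurable fun y => ENNReal.ofReal (wC b ε P y) * F (PsiC P y) :=
    (wC_measurable b ε P).ennreal_ofReal.mul (hF.comp (PsiC_measurable P))
  have hpol := polar_avg _ hH
  have e2 : ∫⁻ y in ({0}ᶜ : Set R3),
      ENNReal.ofReal (‖PsiC P y‖ * ‖P - PsiC P y‖ / (2 * (EE P y * ‖y‖))) *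
        (ENNReal.ofReal (kC b ε (PsiC P y) (P - PsiC P y)) * F (PsiC P y)) =
      ∫⁻ y in ({0}ᶜ : Set R3), ENNReal.ofReal (wC b ε P y) * F (PsiC P y) := by
    refine setLIntegral_congr_fun hms fun y hy => ?_
    rw [← mul_assoc, det_mul_kC b ε P y hy]
  rw [e2, ← hpol]
  refine setLIntegral_congr_fun hms fun y hy => ?_
  rw [← lintegral_const_mul' _ _ ENNReal.ofReal_ne_top]
  refine lintegral_congr fun ω => ?_
  have hω : ‖(ω : R3)‖ = 1 := by simp
  rw [← mul_assoc, det_mul_kC b ε P y hy]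
  have hr := relMom_PsiC P y hy
  rw [pPost_eq _ _ _ hω (by rw [hr]; exact norm_pos_iff.2 hy), hr, add_sub_cancel]
  congr 2
  simp [wC, EE, norm_smul]

lemma collision_bound (b ε : ℝ) (hb : 0 < b) (hε : 0 < ε) (F : R3 × R3 → ℝ≥0∞)
    (hF : Measurable F) :
    ∫⁻ p, ∫⁻ q, ∫⁻ ω : sphere (0 : R3) 1,
      ENNReal.ofReal (kC b ε p q) * F (pPost p q ω, qPost p q ω) ∂sphMeasure
      ≤ sphMeasure Set.univ * (ENNReal.ofReal (4 * ε ^ (-b)) * ∫⁻ p, ∫⁻ q, F (p, q)) := by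
  have hmeas : Measurable fun z : (R3 × R3) × sphere (0 : R3) 1 =>
      ENNReal.ofReal (kC b ε z.1.1 z.1.2) *
        F (pPost z.1.1 z.1.2 z.2, qPost z.1.1 z.1.2 z.2) :=
    ((kC_measurable b ε).comp measurable_fst).ennreal_ofReal.mul
      (hF.comp (pPost_measurable.prodMk qPost_measurable))
  have hmeas2 : Measurable fun z : R3 × R3 => ∫⁻ ω : sphere (0 : R3) 1,
      ENNReal.ofReal (kC b ε z.1 z.2) * F (pPost z.1 z.2 ω, qPost z.1 z.2 ω) ∂sphMeasure :=
    hmeas.lintegral_prod_right'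
  have hsub : Measurable fun z : R3 × R3 => (z.1, z.2 - z.1) := by fun_prop
  calc ∫⁻ p, ∫⁻ q, ∫⁻ ω : sphere (0 : R3) 1,
      ENNReal.ofReal (kC b ε p q) * F (pPost p q ω, qPost p q ω) ∂sphMeasure
      = ∫⁻ p, ∫⁻ P, ∫⁻ ω : sphere (0 : R3) 1,
      ENNReal.ofReal (kC b ε p (P - p)) *
        F (pPost p (P - p) ω, qPost p (P - p) ω) ∂sphMeasure := by
        refine lintegral_congr fun p => ?_
        exact (lintegral_sub_right_eq_self (μ := (volume : Measure R3))
          (fun q => ∫⁻ ω : sphere (0 : R3) 1,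
          ENNReal.ofReal (kC b ε p q) * F (pPost p q ω, qPost p q ω) ∂sphMeasure) p).symm
    _ = ∫⁻ P, ∫⁻ p, ∫⁻ ω : sphere (0 : R3) 1,
      ENNReal.ofReal (kC b ε p (P - p)) *
        F (pPost p (P - p) ω, qPost p (P - p) ω) ∂sphMeasure :=
        lintegral_lintegral_swap (hmeas2.comp hsub).aemeasurable
    _ = ∫⁻ P, sphMeasure Set.univ * ∫⁻ p, ENNReal.ofReal (kC b ε p (P - p)) * F (p, P - p) := by
        refine lintegral_congr fun P => ?_
        rw [← fiber_eq b ε hε P (fun p => F (p, P - p)) (by fun_prop)]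
        simp only [qPost_eq, add_sub_cancel]
    _ ≤ ∫⁻ P, sphMeasure Set.univ * (ENNReal.ofReal (4 * ε ^ (-b)) * ∫⁻ p, F (p, P - p)) := by
        refine lintegral_mono fun P => ?_
        rw [← lintegral_const_mul' _ _ ENNReal.ofReal_ne_top]
        gcongr
        exact kC_le b ε hb hε _ _
    _ = sphMeasure Set.univ * (ENNReal.ofReal (4 * ε ^ (-b)) * ∫⁻ P, ∫⁻ p, F (p, P - p)) := by
        rw [lintegral_const_mul' _ _ (measure_ne_top _ _),
          lintegral_const_mul' _ _ ENNReal.ofReal_ne_top]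
    _ = _ := by
        congr 2
        rw [lintegral_lintegral_swap
          (f := fun P p => F (p, P - p)) (by
            have : Measurable fun z : R3 × R3 => F (z.2, z.1 - z.2) := by fun_prop
            exact this.aemeasurable)]
        refine lintegral_congr fun p => ?_
        exact lintegral_sub_right_eq_self (μ := (volume : Measure R3)) (fun q => F (p, q)) p

lemma coll_meas1 (b ε : ℝ) (F : R3 × R3 → ℝ≥0∞) (hF : Measurable F) :
    Measurable fun z : (R3 × R3) × sphere (0 : R3) 1 =>
      ENNReal.ofReal (kC b ε z.1.1 z.1.2) *
        F (pPost z.1.1 z.1.2 z.2, qPost z.1.1 z.1.2 z.2) :=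
    ((kC_measurable b ε).comp measurable_fst).ennreal_ofReal.mul
      (hF.comp (pPost_measurable.prodMk qPost_measurable))

lemma coll_meas2 (b ε : ℝ) (F : R3 × R3 → ℝ≥0∞) (hF : Measurable F) :
    Measurable fun z : R3 × R3 => ∫⁻ ω : sphere (0 : R3) 1,
      ENNReal.ofReal (kC b ε z.1 z.2) * F (pPost z.1 z.2 ω, qPost z.1 z.2 ω) ∂sphMeasure :=
    (coll_meas1 b ε F hF).lintegral_prod_right'

lemma iter_meas (G : R3 × R3 → ℝ≥0∞) (hG : Measurable G) :
    Measurable fun p : R3 => ∫⁻ q, G (p, q) := hG.lintegral_prod_right'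

lemma iter_zero (G : R3 × R3 → ℝ≥0∞) (hG : Measurable G) (h : ∫⁻ p, ∫⁻ q, G (p, q) = 0) :
    ∀ᵐ p : R3, ∀ᵐ q : R3, G (p, q) = 0 := by
  have h1 := (lintegral_eq_zero_iff (iter_meas G hG)).1 h
  filter_upwards [h1] with p hp
  exact (lintegral_eq_zero_iff (hG.comp measurable_prodMk_left)).1 hp

lemma iter_fin (G : R3 × R3 → ℝ≥0∞) (hG : Measurable G) (h : ∫⁻ p, ∫⁻ q, G (p, q) ≠ ⊤) :
    ∀ᵐ p : R3, ∫⁻ q, G (p, q) < ⊤ := ae_lt_top (iter_meas G hG) h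

lemma collision_zero (b ε : ℝ) (F : R3 × R3 → ℝ≥0∞) (hF : Measurable F)
    (h : ∫⁻ p, ∫⁻ q, ∫⁻ ω : sphere (0 : R3) 1,
      ENNReal.ofReal (kC b ε p q) * F (pPost p q ω, qPost p q ω) ∂sphMeasure = 0) :
    ∀ᵐ p : R3, ∀ᵐ q : R3, ∀ᵐ ω : sphere (0 : R3) 1 ∂sphMeasure,
      ENNReal.ofReal (kC b ε p q) * F (pPost p q ω, qPost p q ω) = 0 := by
  filter_upwards [iter_zero _ (coll_meas2 b ε F hF) h] with p hp
  filter_upwards [hp] with q hq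
  exact (lintegral_eq_zero_iff ((coll_meas1 b ε F hF).comp
    (measurable_prodMk_left (x := (p, q))))).1 hq

lemma collision_fin (b ε : ℝ) (F : R3 × R3 → ℝ≥0∞) (hF : Measurable F)
    (h : ∫⁻ p, ∫⁻ q, ∫⁻ ω : sphere (0 : R3) 1,
      ENNReal.ofReal (kC b ε p q) * F (pPost p q ω, qPost p q ω) ∂sphMeasure ≠ ⊤) :
    ∀ᵐ p : R3, ∫⁻ q, ∫⁻ ω : sphere (0 : R3) 1,
      ENNReal.ofReal (kC b ε p q) * F (pPost p q ω, qPost p q ω) ∂sphMeasure < ⊤ :=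
  iter_fin _ (coll_meas2 b ε F hF) h

lemma collision_ae_null (b ε : ℝ) (hb : 0 < b) (hε : 0 < ε) (N : Set R3)
    (hN : MeasurableSet N) (hN0 : volume N = 0) :
    ∀ᵐ p : R3, ∀ᵐ q : R3, ∀ᵐ ω : sphere (0 : R3) 1 ∂sphMeasure,
      kC b ε p q ≠ 0 → pPost p q ω ∉ N ∧ qPost p q ω ∉ N := by
  set B : Set (R3 × R3) := N ×ˢ Set.univ ∪ Set.univ ×ˢ N with hB
  have hBm : MeasurableSet B := (hN.prod MeasurableSet.univ).union (MeasurableSet.univ.prod hN)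
  have hB0 : ((volume : Measure R3).prod (volume : Measure R3)) B = 0 := by
    apply measure_union_null
    · rw [Measure.prod_prod, hN0, zero_mul]
    · rw [Measure.prod_prod, hN0, mul_zero]
  set F : R3 × R3 → ℝ≥0∞ := B.indicator 1 with hFd
  have hF : Measurable F := measurable_one.indicator hBm
  have hF0 : ∫⁻ p, ∫⁻ q, F (p, q) = 0 := by
    rw [← lintegral_prod F hF.aemeasurable, hFd, lintegral_indicator_one hBm, hB0]
  have hbound := collision_bound b ε hb hε F hF
  rw [hF0, mul_zero, mul_zero] at hbound
  have h1 := collision_zero b ε F hF (le_antisymm hbound (zero_le))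
  filter_upwards [h1] with p hp
  filter_upwards [hp] with q hq
  filter_upwards [hq] with ω hω hk
  have hk' : ENNReal.ofReal (kC b ε p q) ≠ 0 := by
    have := lt_of_le_of_ne (kC_nonneg b ε p q) (Ne.symm hk)
    simpa using this
  have hF0' : F (pPost p q ω, qPost p q ω) = 0 := by
    rcases mul_eq_zero.1 hω with h | h
    · exact absurd h hk'
    · exact h
  have hnB : (pPost p q ω, qPost p q ω) ∉ B := by
    intro hmem
    rw [hFd, Set.indicator_of_mem hmem] at hF0'
    simp at hF0'
  constructor
  · intro h; exact hnB (Or.inl ⟨h, trivial⟩)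
  · intro h; exact hnB (Or.inr ⟨trivial, h⟩)

lemma Qcoll_congr (C₁ b ε : ℝ) (hb : 0 < b) (hε : 0 < ε) (f g : R3 → ℝ)
    (h : ∀ᵐ p : R3, f p = g p) : ∀ᵐ p : R3, Qcoll C₁ b ε f p = Qcoll C₁ b ε g p := by
  have hN0 : volume (toMeasurable volume {p : R3 | f p ≠ g p}) = 0 := by
    rw [measure_toMeasurable]; exact h
  have hN : ∀ p, p ∉ toMeasurable volume {p : R3 | f p ≠ g p} → f p = g p := by
    intro p hp
    by_contra hc
    exact hp (subset_toMeasurable _ _ hc)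
  filter_upwards [h, collision_ae_null b ε hb hε _ (measurableSet_toMeasurable _ _) hN0]
    with p hp hcol
  unfold Qcoll
  congr 1
  apply integral_congr_ae
  filter_upwards [h, hcol] with q hq hcolq
  apply integral_congr_ae
  filter_upwards [hcolq] with ω hω
  change kC b ε p q * _ = kC b ε p q * _
  by_cases hk : kC b ε p q = 0
  · simp [hk]
  · obtain ⟨h1, h2⟩ := hω hk
    rw [hN _ h1, hN _ h2, hp, hq]

lemma GammaOp_congr (C₁ b ε μ : ℝ) (hb : 0 < b) (hε : 0 < ε) (f g : R3 → ℝ)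
    (h : ∀ᵐ p : R3, f p = g p) : ∀ᵐ p : R3, GammaOp C₁ b ε μ f p = GammaOp C₁ b ε μ g p := by
  filter_upwards [h, Qcoll_congr C₁ b ε hb hε f g h] with p hp hQ
  unfold GammaOp
  rw [hQ, hp, integral_congr_ae h]

/-- gain integrand -/
def gainC (b ε : ℝ) (f : R3 → ℝ) (p : R3) (z : R3 × sphere (0 : R3) 1) : ℝ :=
  kC b ε p z.1 * (f (pPost p z.1 z.2) * f (qPost p z.1 z.2))

lemma gainaux_hm (p : R3) : Measurable fun z : R3 × sphere (0 : R3) 1 => ((p, z.1), z.2) := 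
  (measurable_const.prodMk measurable_fst).prodMk measurable_snd
lemma gainaux_h1 (p : R3) : Measurable fun z : R3 × sphere (0 : R3) 1 => pPost p z.1 z.2 := by
  have h := pPost_measurable.comp (gainaux_hm p)
  simp only [Function.comp_def] at h
  exact h
lemma gainaux_h2 (p : R3) : Measurable fun z : R3 × sphere (0 : R3) 1 => qPost p z.1 z.2 := by
  have h := qPost_measurable.comp (gainaux_hm p)
  simp only [Function.comp_def] at h
  exact h
lemma gainaux_h3 (b ε : ℝ) (p : R3) : Measurable fun q : R3 => kC b ε p q := by
  have h := (kC_measurable b ε).comp (measurable_prodMk_left (x := p))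
  simp only [Function.comp_def] at h
  exact h
lemma gainaux_h4 (b ε : ℝ) (p : R3) :Measurable fun z : R3 × sphere (0 : R3) 1 => kC b ε p z.1 := (gainaux_h3 b ε p).comp measurable_fst
lemma gainaux_h5  (f : R3 → ℝ) (hf : Measurable f) (p : R3) : Measurable fun z : R3 × sphere (0 : R3) 1 => f (pPost p z.1 z.2) := hf.comp (gainaux_h1 p)
lemma gainaux_h6  (f : R3 → ℝ) (hf : Measurable f) (p : R3) : Measurable fun z : R3 × sphere (0 : R3) 1 => f (qPost p z.1 z.2) := hf.comp (gainaux_h2 p)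
lemma gainC_measurable (b ε : ℝ) (f : R3 → ℝ) (hf : Measurable f) (p : R3) :
    Measurable (gainC b ε f p) := 
  (gainaux_h4 b ε p).mul ((gainaux_h5 f hf p).mul (gainaux_h6 f hf p))

lemma gain_integrable (b ε : ℝ) (hb : 0 < b) (hε : 0 < ε) (f : R3 → ℝ) (hf : Measurable f)
    (hf0 : ∀ p, 0 ≤ f p) (hfi : Integrable f) :
    ∀ᵐ p : R3, Integrable (gainC b ε f p) ((volume : Measure R3).prod sphMeasure) := by
  set F : R3 × R3 → ℝ≥0∞ := fun z => ENNReal.ofReal (f z.1 * f z.2) with hFd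
  have hF : Measurable F := by
    have h1 : Measurable fun z : R3 × R3 => f z.1 := hf.comp measurable_fst
    have h2 : Measurable fun z : R3 × R3 => f z.2 := hf.comp measurable_snd
    exact (h1.mul h2).ennreal_ofReal
  have hFtop : ∫⁻ p, ∫⁻ q, F (p, q) ≠ ⊤ := by
    rw [← lintegral_prod F hF.aemeasurable]
    have h := (hfi.mul_prod hfi).lintegral_lt_top
    exact h.ne
  have hbound := collision_bound b ε hb hε F hF
  have hlt : ∫⁻ p, ∫⁻ q, ∫⁻ ω : sphere (0 : R3) 1,
      ENNReal.ofReal (kC b ε p q) * F (pPost p q ω, qPost p q ω) ∂sphMeasure ≠ ⊤ := by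
    refine ne_top_of_le_ne_top ?_ hbound
    exact ENNReal.mul_ne_top (measure_ne_top _ _) (ENNReal.mul_ne_top ENNReal.ofReal_ne_top hFtop)
  filter_upwards [collision_fin b ε F hF hlt] with p hp
  have hgm := gainC_measurable b ε f hf p
  have hg0 : ∀ z, 0 ≤ gainC b ε f p z := fun z =>
    mul_nonneg (kC_nonneg _ _ _ _) (mul_nonneg (hf0 _) (hf0 _))
  refine ⟨hgm.aestronglyMeasurable, ?_⟩
  rw [hasFiniteIntegral_iff_ofReal (Filter.Eventually.of_forall hg0),
    lintegral_prod _ hgm.ennreal_ofReal.aemeasurable]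
  refine lt_of_eq_of_lt ?_ hp
  refine lintegral_congr fun q => lintegral_congr fun ω => ?_
  exact ENNReal.ofReal_mul (kC_nonneg _ _ _ _)

lemma kf_integrable (b ε : ℝ) (hb : 0 < b) (hε : 0 < ε) (f : R3 → ℝ) (hfi : Integrable f)
    (p : R3) : Integrable fun q => kC b ε p q * f q := by
  refine hfi.bdd_mul (c := 4 * ε ^ (-b)) ?_ ?_
  · exact ((kC_measurable b ε).comp measurable_prodMk_left).aestronglyMeasurable
  · refine Filter.Eventually.of_forall fun q => ?_
    rw [Real.norm_of_nonneg (kC_nonneg _ _ _ _)]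
    exact kC_le b ε hb hε p q

lemma Qcoll_eq (C₁ b ε : ℝ) (hb : 0 < b) (hε : 0 < ε) (f : R3 → ℝ) (hfi : Integrable f) (p : R3)
    (hg : Integrable (gainC b ε f p) ((volume : Measure R3).prod sphMeasure)) :
    Qcoll C₁ b ε f p = C₁ * ((∫ z, gainC b ε f p z ∂((volume : Measure R3).prod sphMeasure))
      - f p * (sphMeasure.real Set.univ * ∫ q, kC b ε p q * f q)) := by
  have hk := kf_integrable b ε hb hε f hfi p
  have hl : Integrable (fun z : R3 × sphere (0 : R3) 1 => f p * (kC b ε p z.1 * f z.1))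
      ((volume : Measure R3).prod sphMeasure) := (hk.comp_fst sphMeasure).const_mul (f p)
  have hl2 : ∫ z : R3 × sphere (0 : R3) 1, f p * (kC b ε p z.1 * f z.1)
      ∂((volume : Measure R3).prod sphMeasure) =
      f p * (sphMeasure.real Set.univ * ∫ q, kC b ε p q * f q) := by
    rw [integral_prod _ hl]
    simp only [integral_const, smul_eq_mul, integral_const_mul]
    ring
  rw [← hl2, ← integral_sub hg hl, integral_prod
    (fun z => gainC b ε f p z - f p * (kC b ε p z.1 * f z.1)) (hg.sub hl)]
  unfold Qcoll
  congr 1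
  refine integral_congr_ae (Filter.Eventually.of_forall fun q => ?_)
  refine integral_congr_ae (Filter.Eventually.of_forall fun ω => ?_)
  simp only [gainC, kC]
  ring

lemma GammaOp_mono_aux (C₁ b ε μ : ℝ) (hC₁ : 0 < C₁) (hb : 0 < b) (hε : 0 < ε)
    (hμ : C₁ * (sphMeasure.real Set.univ * (4 * ε ^ (-b))) ≤ μ) (f g : R3 → ℝ)
    (hfm : Measurable f) (hgm : Measurable g) (hfi : Integrable f) (hgi : Integrable g)
    (hg0 : ∀ p, 0 ≤ g p) (hgf : ∀ p, g p ≤ f p) :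
    ∀ᵐ p : R3, GammaOp C₁ b ε μ g p ≤ GammaOp C₁ b ε μ f p := by
  have hf0 : ∀ p, 0 ≤ f p := fun p => (hg0 p).trans (hgf p)
  filter_upwards [gain_integrable b ε hb hε f hfm hf0 hfi,
    gain_integrable b ε hb hε g hgm hg0 hgi] with p hF hG
  unfold GammaOp
  rw [Qcoll_eq C₁ b ε hb hε f hfi p hF, Qcoll_eq C₁ b ε hb hε g hgi p hG]
  have hA : (∫ z, gainC b ε g p z ∂((volume : Measure R3).prod sphMeasure)) ≤
      ∫ z, gainC b ε f p z ∂((volume : Measure R3).prod sphMeasure) := by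
    refine integral_mono hG hF fun z => ?_
    unfold gainC
    exact mul_le_mul_of_nonneg_left
      (mul_le_mul (hgf _) (hgf _) (hg0 _) (hf0 _)) (kC_nonneg _ _ _ _)
  set S := sphMeasure.real Set.univ with hS
  have hS0 : 0 ≤ S := measureReal_nonneg
  have hc : ∀ q, 0 ≤ μ - C₁ * (S * kC b ε p q) := by
    intro q
    have h1 : C₁ * (S * kC b ε p q) ≤ C₁ * (S * (4 * ε ^ (-b))) := by
      have := kC_le b ε hb hε p q
      gcongr
    linarith
  have hL : ∀ h : R3 → ℝ, Integrable h →
      Integrable (fun q => (μ - C₁ * (S * kC b ε p q)) * h q) ∧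
      ∫ q, (μ - C₁ * (S * kC b ε p q)) * h q =
        μ * (∫ q, h q) - C₁ * (S * ∫ q, kC b ε p q * h q) := by
    intro h hh
    have hk := kf_integrable b ε hb hε h hh p
    have e : (fun q => (μ - C₁ * (S * kC b ε p q)) * h q) =
        fun q => μ * h q - C₁ * (S * (kC b ε p q * h q)) := by
      funext q; ring
    rw [e]
    have i1 := hh.const_mul μ
    have i2 := (hk.const_mul S).const_mul C₁
    refine ⟨i1.sub i2, ?_⟩
    rw [integral_sub i1 i2, integral_const_mul, integral_const_mul, integral_const_mul]
  obtain ⟨if1, if2⟩ := hL f hfi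
  obtain ⟨ig1, ig2⟩ := hL g hgi
  have hLg : 0 ≤ ∫ q, (μ - C₁ * (S * kC b ε p q)) * g q :=
    integral_nonneg fun q => mul_nonneg (hc q) (hg0 q)
  have hLfg : ∫ q, (μ - C₁ * (S * kC b ε p q)) * g q ≤
      ∫ q, (μ - C₁ * (S * kC b ε p q)) * f q :=
    integral_mono ig1 if1 fun q => mul_le_mul_of_nonneg_left (hgf q) (hc q)
  have hprod := mul_le_mul (hgf p) hLfg hLg (hf0 p)
  rw [if2, ig2] at hprod
  have hA' := mul_le_mul_of_nonneg_left hA hC₁.le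
  linarith

/-- **Lemma 6 (monotonicity).** For sufficiently large `μ` (depending only on `C₁, b, ε`),
`f ≥ g ≥ 0` a.e. implies `Γ^μ_ε(f) ≥ Γ^μ_ε(g)` a.e. -/
theorem gammaOp_monotone (C₁ b ε : ℝ) (hC₁ : 0 < C₁) (hb1 : 1 < b) (hb2 : b < 2)
    (hε : 0 < ε) :
    ∃ μ₀ : ℝ, 0 < μ₀ ∧ ∀ μ : ℝ, μ₀ ≤ μ →
      ∀ f g : R3 → ℝ, Integrable f → Integrable g →
        (∀ᵐ p : R3, 0 ≤ g p) → (∀ᵐ p : R3, g p ≤ f p) →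
        ∀ᵐ p : R3, GammaOp C₁ b ε μ g p ≤ GammaOp C₁ b ε μ f p := by

  have hb : 0 < b := by linarith
  have hS0 : 0 ≤ sphMeasure.real Set.univ := measureReal_nonneg
  refine ⟨C₁ * (sphMeasure.real Set.univ * (4 * ε ^ (-b))) + 1, by positivity, ?_⟩
  intro μ hμ f g hf hg hg0 hgf
  -- measurable, everywhere ordered representatives
  set g' : R3 → ℝ := fun p => max (hg.1.mk g p) 0 with hg'd
  set f' : R3 → ℝ := fun p => max (hf.1.mk f p) (g' p) with hf'd
  have hg'm : Measurable g' := hg.1.stronglyMeasurable_mk.measurable.max measurable_const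
  have hf'm : Measurable f' := hf.1.stronglyMeasurable_mk.measurable.max hg'm
  have hgg' : ∀ᵐ p : R3, g p = g' p := by
    filter_upwards [hg.1.ae_eq_mk, hg0] with p h1 h2
    rw [hg'd]
    simp only
    rw [← h1, max_eq_left h2]
  have hff' : ∀ᵐ p : R3, f p = f' p := by
    filter_upwards [hf.1.ae_eq_mk, hgg', hgf] with p h1 h2 h3
    rw [hf'd]
    simp only
    rw [← h1, ← h2, max_eq_left h3]
  have hmono := GammaOp_mono_aux C₁ b ε μ hC₁ hb hε (by linarith) f' g' hf'm hg'm
    (hf.congr hff') (hg.congr hgg') (fun p => le_max_right _ _) (fun p => le_max_right _ _)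
  filter_upwards [hmono, GammaOp_congr C₁ b ε μ hb hε f f' hff',
    GammaOp_congr C₁ b ε μ hb hε g g' hgg'] with p h1 h2 h3
  rw [h2, h3]
  exact h1
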